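/- arXiv:2110.06984 — 2 statements merged into one kernel-verified Lean document; each statement's English description precedes it below -/
import Mathlib

section
/- For every 0 < λ ≤ 1/2 and every c > 0 there exists a bounded symmetric measurable function w : [0,1]² → ℝ such that ‖B_λ(w)‖_□ > c·‖w‖_□. In particular, the banded cut operator B_λ is unbounded on the space of bounded symmetric measurable functions on [0,1]² equipped with the cut norm (and hence on the space of symmetric L^p functions equipped with the cut norm, for every 1 ≤ p ≤ ∞). -/
open MeasureTheory Filter

/-- Cut norm of a function on `[0,1]²`:
`sup_{S,T ⊆ [0,1] measurable} |∫_{S×T} w(x,y) dx dy|`. -/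
noncomputable def cutNormFn (w : ℝ → ℝ → ℝ) : ℝ :=
  sSup {r : ℝ | ∃ S T : Set ℝ, MeasurableSet S ∧ MeasurableSet T ∧
    S ⊆ Set.Icc 0 1 ∧ T ⊆ Set.Icc 0 1 ∧ r = |∫ p in S ×ˢ T, w p.1 p.2|}

/-- The banded indicator `χ_λ(x,y) = 1` if `|x - y| ≤ 1 - λ` and `0` otherwise. -/
noncomputable def chiBand (lam : ℝ) (x y : ℝ) : ℝ := if |x - y| ≤ 1 - lam then 1 else 0

/-- The character `x ↦ exp(-2πi n x / L)`. -/
noncomputable def expChar (L : ℝ) (n : ℕ) (x : ℝ) : ℂ :=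
  Complex.exp ((-(2 * Real.pi * n * x / L) : ℝ) * Complex.I)

lemma continuous_expChar (L : ℝ) (n : ℕ) : Continuous (expChar L n) := by
  unfold expChar; fun_prop

lemma norm_expChar (L : ℝ) (n : ℕ) (x : ℝ) : ‖expChar L n x‖ = 1 := by
  rw [expChar, Complex.norm_exp_ofReal_mul_I]

/-- Bessel's inequality for the indicator function of `T`. -/
lemma sum_sq_norm_setIntegral_expChar_le {a b : ℝ} (hab : a < b) {T : Set ℝ}
    (hT : MeasurableSet T) (hTs : T ⊆ Set.Ioc a b) (N : ℕ) :
    ∑ n ∈ Finset.range N, ‖∫ x in T, expChar (b - a) (n + 1) x‖ ^ 2 ≤ (b - a) ^ 2 := by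
  have hpos : 0 < b - a := sub_pos.2 hab
  set g : ℝ → ℂ := T.indicator (fun _ => 1) with hg
  have hgm : AEStronglyMeasurable g (volume.restrict (Set.Ioc a b)) :=
    (stronglyMeasurable_const.indicator hT).aestronglyMeasurable
  have hgn : ∀ x, ‖g x‖ ≤ 1 := by
    intro x
    by_cases hx : x ∈ T <;> simp [hg, hx]
  have hL2 : MemLp g 2 (volume.restrict (Set.Ioc a b)) :=
    MemLp.of_bound hgm 1 (Eventually.of_forall hgn)
  have hsum := hasSum_sq_fourierCoeffOn hab hL2
  have hcoef : ∀ n : ℕ, fourierCoeffOn hab g (n : ℤ)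
      = ((1 / (b - a) : ℝ)) • ∫ x in T, expChar (b - a) n x := by
    intro n
    rw [fourierCoeffOn_eq_integral, intervalIntegral.integral_of_le hab.le]
    congr 1
    have : ∀ x : ℝ, fourier (-(n : ℤ)) (x : AddCircle (b - a)) • g x
        = T.indicator (expChar (b - a) n) x := by
      intro x
      by_cases hx : x ∈ T
      · simp only [hg, hx, Set.indicator_of_mem, smul_eq_mul, mul_one, fourier_coe_apply, expChar]
        congr 1
        push_cast
        ring
      · simp [hg, hx]
    simp_rw [this]
    rw [setIntegral_indicator hT, Set.inter_eq_self_of_subset_right hTs]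
  have hle : ∑ n ∈ Finset.range N, ‖fourierCoeffOn hab g ((n + 1 : ℕ) : ℤ)‖ ^ 2
      ≤ (b - a)⁻¹ • ∫ x in a..b, ‖g x‖ ^ 2 := by
    have hinj : Function.Injective (fun n : ℕ => ((n + 1 : ℕ) : ℤ)) := by
      intro m n h
      simpa using h
    have h := sum_le_hasSum (Finset.map ⟨_, hinj⟩ (Finset.range N))
      (fun i _ => by positivity) hsum
    simpa using h
  have hone : (b - a)⁻¹ • ∫ x in a..b, ‖g x‖ ^ 2 ≤ 1 := by
    have h1 : ‖∫ x in a..b, ‖g x‖ ^ 2‖ ≤ 1 * |b - a| := by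
      refine intervalIntegral.norm_integral_le_of_norm_le_const fun x _ => ?_
      rw [Real.norm_of_nonneg (by positivity)]
      exact pow_le_one₀ (norm_nonneg _) (hgn x)
    rw [abs_of_pos hpos, one_mul] at h1
    rw [smul_eq_mul, inv_mul_le_iff₀ hpos, mul_one]
    exact (Real.le_norm_self _).trans h1
  have hfin := hle.trans hone
  simp_rw [hcoef, norm_smul, mul_pow] at hfin
  rw [← Finset.mul_sum, Real.norm_of_nonneg (by positivity), one_div, inv_pow,
    inv_mul_le_iff₀ (by positivity), mul_one] at hfin
  exact hfin

/-- The sine of a phase difference integrates over a rectangle to at most a product of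
exponential integrals. -/
lemma abs_setIntegral_prod_sin_le (L d : ℝ) (n : ℕ) (S T : Set ℝ)
    (hSf : volume S < ⊤) (hTf : volume T < ⊤) :
    |∫ p in S ×ˢ T, Real.sin (2 * Real.pi * n * (p.2 - p.1 - d) / L)|
      ≤ ‖∫ x in S, expChar L n x‖ * ‖∫ y in T, expChar L n y‖ := by
  have key : ∀ p : ℝ × ℝ, Real.sin (2 * Real.pi * n * (p.2 - p.1 - d) / L)
      = RCLike.im ((expChar L n p.1 * expChar L n d) * (starRingEnd ℂ) (expChar L n p.2)) := by
    intro p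
    simp only [expChar, ← Complex.exp_conj, ← Complex.exp_add]
    have : ((-(2 * Real.pi * n * p.1 / L) : ℝ) : ℂ) * Complex.I
        + ((-(2 * Real.pi * n * d / L) : ℝ) : ℂ) * Complex.I
        + (starRingEnd ℂ) (((-(2 * Real.pi * n * p.2 / L) : ℝ) : ℂ) * Complex.I)
        = ((2 * Real.pi * n * (p.2 - p.1 - d) / L : ℝ) : ℂ) * Complex.I := by
      simp only [map_mul, Complex.conj_ofReal, Complex.conj_I]
      push_cast
      ring
    rw [this]
    exact (Complex.exp_ofReal_mul_I_im _).symm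
  have hc := continuous_expChar L n
  have hint : IntegrableOn (fun p : ℝ × ℝ =>
      (expChar L n p.1 * expChar L n d) * (starRingEnd ℂ) (expChar L n p.2)) (S ×ˢ T) := by
    refine IntegrableOn.of_bound (C := 1) ?_ ?_ (Eventually.of_forall fun p => ?_)
    · rw [Measure.volume_eq_prod, Measure.prod_prod]
      exact ENNReal.mul_lt_top hSf hTf
    · refine Continuous.aestronglyMeasurable ?_
      have := Complex.continuous_conj
      fun_prop
    · simp [norm_expChar]
  simp_rw [key]
  rw [integral_im hint]
  refine (RCLike.abs_im_le_norm _).trans ?_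
  rw [Measure.volume_eq_prod,
    setIntegral_prod_mul (fun x => expChar L n x * expChar L n d)
      (fun y => (starRingEnd ℂ) (expChar L n y)), integral_mul_const, integral_conj]
  simp [norm_expChar]

/-- The conjugate Dirichlet kernel `∑_{n=1}^N sin(2πn u / L)`. -/
noncomputable def conjDirichlet (L : ℝ) (N : ℕ) (u : ℝ) : ℝ :=
  ∑ n ∈ Finset.range N, Real.sin (2 * Real.pi * (n + 1 : ℕ) * u / L)

lemma continuous_conjDirichlet (L : ℝ) (N : ℕ) : Continuous (conjDirichlet L N) := by
  unfold conjDirichlet; fun_prop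

lemma abs_conjDirichlet_le (L : ℝ) (N : ℕ) (u : ℝ) : |conjDirichlet L N u| ≤ N := by
  refine (Finset.abs_sum_le_sum_abs _ _).trans ?_
  refine (Finset.sum_le_sum fun n _ => Real.abs_sin_le_one _).trans ?_
  simp

/-- Bounded measurable functions are integrable on rectangles with sides of finite measure. -/
lemma integrableOn_prod_of_bounded {S T : Set ℝ} (hSf : volume S < ⊤) (hTf : volume T < ⊤)
    {f : ℝ × ℝ → ℝ} (hf : Measurable f) {C : ℝ} (hC : ∀ p, |f p| ≤ C) :
    IntegrableOn f (S ×ˢ T) := by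
  refine IntegrableOn.of_bound (C := C) ?_ hf.aestronglyMeasurable (Eventually.of_forall hC)
  rw [Measure.volume_eq_prod, Measure.prod_prod]
  exact ENNReal.mul_lt_top hSf hTf

/-- Convolution with the conjugate Dirichlet kernel is bounded on indicators, uniformly in `N`. -/
lemma abs_setIntegral_prod_conjDirichlet_le {L a c : ℝ} (d : ℝ) (hL : 0 < L) (N : ℕ)
    {S T : Set ℝ} (hS : MeasurableSet S) (hT : MeasurableSet T)
    (hSs : S ⊆ Set.Ioc a (a + L)) (hTs : T ⊆ Set.Ioc c (c + L)) :
    |∫ p in S ×ˢ T, conjDirichlet L N (p.2 - p.1 - d)| ≤ L ^ 2 := by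
  have hSf : volume S < ⊤ := (measure_mono hSs).trans_lt measure_Ioc_lt_top
  have hTf : volume T < ⊤ := (measure_mono hTs).trans_lt measure_Ioc_lt_top
  unfold conjDirichlet
  rw [integral_finsetSum]
  swap
  · intro n _
    exact integrableOn_prod_of_bounded hSf hTf (by fun_prop) (fun p => Real.abs_sin_le_one _)
  have h1 := sum_sq_norm_setIntegral_expChar_le (lt_add_of_pos_right a hL) hS hSs N
  have h2 := sum_sq_norm_setIntegral_expChar_le (lt_add_of_pos_right c hL) hT hTs N
  rw [add_sub_cancel_left] at h1 h2
  calc _ ≤ ∑ n ∈ Finset.range N,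
        |∫ p in S ×ˢ T, Real.sin (2 * Real.pi * (n + 1 : ℕ) * (p.2 - p.1 - d) / L)| :=
        Finset.abs_sum_le_sum_abs _ _
    _ ≤ ∑ n ∈ Finset.range N, (‖∫ x in S, expChar L (n + 1) x‖ ^ 2
          + ‖∫ x in T, expChar L (n + 1) x‖ ^ 2) / 2 := by
        refine Finset.sum_le_sum fun n _ => ?_
        refine (abs_setIntegral_prod_sin_le L d (n + 1) S T hSf hTf).trans ?_
        linarith [two_mul_le_add_sq ‖∫ x in S, expChar L (n + 1) x‖
          ‖∫ x in T, expChar L (n + 1) x‖]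
    _ ≤ L ^ 2 := by
        rw [← Finset.sum_div, Finset.sum_add_distrib]
        linarith

/-- The conjugate Dirichlet kernel placed on the corner `(0, λ] × (1 - λ, 1]`. -/
noncomputable def cornerKernel (lam : ℝ) (N : ℕ) (p : ℝ × ℝ) : ℝ :=
  (Set.Ioc 0 lam ×ˢ Set.Ioc (1 - lam) 1).indicator
    (fun p => conjDirichlet lam N (p.2 - p.1 - (1 - lam))) p

lemma measurable_cornerKernel (lam : ℝ) (N : ℕ) : Measurable (cornerKernel lam N) := by
  have := continuous_conjDirichlet lam N
  exact Measurable.indicator (by fun_prop) (measurableSet_Ioc.prod measurableSet_Ioc)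

lemma abs_cornerKernel_le (lam : ℝ) (N : ℕ) (p : ℝ × ℝ) : |cornerKernel lam N p| ≤ N := by
  unfold cornerKernel
  by_cases h : p ∈ Set.Ioc 0 lam ×ˢ Set.Ioc (1 - lam) 1
  · rw [Set.indicator_of_mem h]
    exact abs_conjDirichlet_le _ _ _
  · rw [Set.indicator_of_notMem h]
    simp

lemma abs_setIntegral_cornerKernel_le {lam : ℝ} (h0 : 0 < lam) (N : ℕ) {S T : Set ℝ}
    (hS : MeasurableSet S) (hT : MeasurableSet T) :
    |∫ p in S ×ˢ T, cornerKernel lam N p| ≤ lam ^ 2 := by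
  unfold cornerKernel
  rw [setIntegral_indicator (measurableSet_Ioc.prod measurableSet_Ioc), Set.prod_inter_prod]
  refine abs_setIntegral_prod_conjDirichlet_le (a := 0) (c := 1 - lam) (1 - lam) h0 N
    (hS.inter measurableSet_Ioc) (hT.inter measurableSet_Ioc) ?_ ?_
  · rw [zero_add]; exact Set.inter_subset_right
  · rw [sub_add_cancel]; exact Set.inter_subset_right

/-- The symmetrization of `cornerKernel`. -/
noncomputable def symCornerKernel (lam : ℝ) (N : ℕ) (x y : ℝ) : ℝ :=
  cornerKernel lam N (x, y) + cornerKernel lam N (y, x)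

lemma measurable_symCornerKernel (lam : ℝ) (N : ℕ) :
    Measurable (fun p : ℝ × ℝ => symCornerKernel lam N p.1 p.2) :=
  (measurable_cornerKernel lam N).add ((measurable_cornerKernel lam N).comp measurable_swap)

lemma abs_symCornerKernel_le (lam : ℝ) (N : ℕ) (x y : ℝ) :
    |symCornerKernel lam N x y| ≤ N + N :=
  (abs_add_le _ _).trans (add_le_add (abs_cornerKernel_le _ _ _) (abs_cornerKernel_le _ _ _))

lemma cutNormFn_symCornerKernel_le {lam : ℝ} (h0 : 0 < lam) (N : ℕ) :
    cutNormFn (symCornerKernel lam N) ≤ 2 * lam ^ 2 := by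
  refine Real.sSup_le ?_ (by positivity)
  rintro r ⟨S, T, hS, hT, hSs, hTs, rfl⟩
  have hSf : volume S < ⊤ := (measure_mono hSs).trans_lt measure_Icc_lt_top
  have hTf : volume T < ⊤ := (measure_mono hTs).trans_lt measure_Icc_lt_top
  have hm := measurable_cornerKernel lam N
  unfold symCornerKernel
  rw [integral_add]
  rotate_left
  · exact integrableOn_prod_of_bounded hSf hTf hm (abs_cornerKernel_le lam N)
  · exact integrableOn_prod_of_bounded hSf hTf (hm.comp measurable_swap)
      (fun p => abs_cornerKernel_le lam N p.swap)
  have hswap : ∫ p in S ×ˢ T, cornerKernel lam N (p.2, p.1)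
      = ∫ p in T ×ˢ S, cornerKernel lam N p := by
    rw [Measure.volume_eq_prod]
    exact setIntegral_prod_swap T S (cornerKernel lam N)
  rw [hswap, two_mul]
  exact (abs_add_le _ _).trans (add_le_add (abs_setIntegral_cornerKernel_le h0 N hS hT)
    (abs_setIntegral_cornerKernel_le h0 N hT hS))

/-- For bounded measurable functions each rectangle gives a lower bound on the cut norm. -/
lemma abs_setIntegral_le_cutNormFn {w : ℝ → ℝ → ℝ} {C : ℝ} (hC : ∀ x y, |w x y| ≤ C)
    {S T : Set ℝ} (hS : MeasurableSet S) (hT : MeasurableSet T)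
    (hSs : S ⊆ Set.Icc 0 1) (hTs : T ⊆ Set.Icc 0 1) :
    |∫ p in S ×ˢ T, w p.1 p.2| ≤ cutNormFn w := by
  refine le_csSup ⟨C, ?_⟩ ⟨S, T, hS, hT, hSs, hTs, rfl⟩
  rintro r ⟨S, T, hS, hT, hSs, hTs, rfl⟩
  have hvol : volume (S ×ˢ T) ≤ 1 := by
    rw [Measure.volume_eq_prod, Measure.prod_prod]
    refine mul_le_one' ((measure_mono hSs).trans ?_) ((measure_mono hTs).trans ?_) <;> simp
  have h := norm_setIntegral_le_of_norm_le_const (μ := volume) (s := S ×ˢ T)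
    (hvol.trans_lt ENNReal.one_lt_top) (f := fun p : ℝ × ℝ => w p.1 p.2) (C := C)
    (fun p _ => hC p.1 p.2)
  refine h.trans (mul_le_of_le_one_right ((abs_nonneg _).trans (hC 0 0)) ?_)
  exact ENNReal.toReal_le_of_le_ofReal zero_le_one (by simpa using hvol)

lemma measurable_chiBand (lam : ℝ) : Measurable (fun p : ℝ × ℝ => chiBand lam p.1 p.2) := by
  unfold chiBand
  exact Measurable.ite (measurableSet_le (by fun_prop) measurable_const) measurable_const
    measurable_const

lemma abs_chiBand_le_one (lam x y : ℝ) : |chiBand lam x y| ≤ 1 := by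
  unfold chiBand; split_ifs <;> simp

/-- The banded cut of a single sine wave has a large integral over the corner. -/
lemma setIntegral_sin_mul_chiBand {lam : ℝ} (h0 : 0 < lam) (h1 : lam ≤ 1 / 2) (n : ℕ) :
    ∫ p in Set.Ioc 0 lam ×ˢ Set.Ioc (1 - lam) 1,
      Real.sin (2 * Real.pi * (n + 1 : ℕ) * (p.2 - p.1 - (1 - lam)) / lam) * chiBand lam p.1 p.2
      = -(lam ^ 2 / (2 * Real.pi)) * (1 / (n + 1)) := by
  have hint : IntegrableOn (fun p : ℝ × ℝ =>
      Real.sin (2 * Real.pi * (n + 1 : ℕ) * (p.2 - p.1 - (1 - lam)) / lam)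
        * chiBand lam p.1 p.2) (Set.Ioc 0 lam ×ˢ Set.Ioc (1 - lam) 1) := by
    refine integrableOn_prod_of_bounded (C := 1) measure_Ioc_lt_top measure_Ioc_lt_top ?_ ?_
    · exact Measurable.mul (by fun_prop) (measurable_chiBand lam)
    · intro p
      rw [abs_mul]
      exact mul_le_one₀ (Real.abs_sin_le_one _) (abs_nonneg _) (abs_chiBand_le_one _ _ _)
  rw [Measure.volume_eq_prod] at hint ⊢
  rw [setIntegral_prod _ hint]
  set k : ℝ := 2 * Real.pi * (n + 1 : ℕ) / lam with hk
  have hkpos : 0 < k := by positivity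
  have hkl : k * lam = (n + 1 : ℕ) * (2 * Real.pi) := by rw [hk]; field_simp
  have hsin : Real.sin ((n + 1 : ℕ) * (2 * Real.pi)) = 0 := by
    simpa using Real.sin_add_nat_mul_two_pi 0 (n + 1)
  have inner : ∀ x ∈ Set.Ioc 0 lam, ∫ y in Set.Ioc (1 - lam) 1,
      Real.sin (2 * Real.pi * (n + 1 : ℕ) * (y - x - (1 - lam)) / lam) * chiBand lam x y
      = -k⁻¹ * (1 - Real.cos (k * x)) := by
    intro x hx
    have hind : ∀ y ∈ Set.Ioc (1 - lam) 1,
        Real.sin (2 * Real.pi * (n + 1 : ℕ) * (y - x - (1 - lam)) / lam) * chiBand lam x y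
        = (Set.Iic (x + 1 - lam)).indicator
          (fun y => Real.sin (k * y - k * (x + (1 - lam)))) y := by
      intro y hy
      have hxy : |x - y| = y - x := by
        rw [abs_sub_comm, abs_of_nonneg]
        linarith [hx.2, hy.1]
      have hmem : |x - y| ≤ 1 - lam ↔ y ∈ Set.Iic (x + 1 - lam) := by
        rw [hxy, Set.mem_Iic]
        constructor <;> intro h <;> linarith
      by_cases hle : |x - y| ≤ 1 - lam
      · rw [Set.indicator_of_mem (hmem.1 hle), chiBand, if_pos hle, mul_one]
        congr 1
        rw [hk]
        ring
      · rw [Set.indicator_of_notMem (fun h => hle (hmem.2 h)), chiBand, if_neg hle, mul_zero]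
    rw [setIntegral_congr_fun measurableSet_Ioc hind, setIntegral_indicator measurableSet_Iic,
      Set.Ioc_inter_Iic, min_eq_right (by linarith [hx.2]),
      ← intervalIntegral.integral_of_le (by linarith [hx.1]),
      intervalIntegral.integral_comp_mul_sub Real.sin hkpos.ne', integral_sin, smul_eq_mul]
    have e1 : k * (1 - lam) - k * (x + (1 - lam)) = -(k * x) := by ring
    have e2 : k * (x + 1 - lam) - k * (x + (1 - lam)) = 0 := by ring
    rw [e1, e2, Real.cos_neg, Real.cos_zero]
    ring
  rw [setIntegral_congr_fun measurableSet_Ioc inner, ← intervalIntegral.integral_of_le h0.le,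
    intervalIntegral.integral_const_mul, intervalIntegral.integral_sub (by simp)
      (Continuous.intervalIntegrable (by fun_prop) _ _),
    intervalIntegral.integral_comp_mul_left Real.cos hkpos.ne', integral_cos, hkl, hsin]
  simp only [intervalIntegral.integral_const, mul_zero, Real.sin_zero, sub_zero, smul_eq_mul,
    mul_one]
  rw [hk]
  push_cast
  field_simp

lemma le_cutNormFn_symCornerKernel_mul_chiBand {lam : ℝ} (h0 : 0 < lam) (h1 : lam ≤ 1 / 2)
    (N : ℕ) :
    lam ^ 2 / (2 * Real.pi) * ∑ n ∈ Finset.range N, (1 / (n + 1) : ℝ)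
      ≤ cutNormFn (fun x y => symCornerKernel lam N x y * chiBand lam x y) := by
  have hb : ∀ x y, |symCornerKernel lam N x y * chiBand lam x y| ≤ (N + N : ℝ) := by
    intro x y
    rw [abs_mul]
    exact (mul_le_of_le_one_right (abs_nonneg _) (abs_chiBand_le_one _ _ _)).trans
      (abs_symCornerKernel_le _ _ _ _)
  refine le_trans ?_ (abs_setIntegral_le_cutNormFn hb (S := Set.Ioc 0 lam)
    (T := Set.Ioc (1 - lam) 1) measurableSet_Ioc measurableSet_Ioc ?_ ?_)
  · have hcongr : ∀ p ∈ Set.Ioc 0 lam ×ˢ Set.Ioc (1 - lam) 1,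
        symCornerKernel lam N p.1 p.2 * chiBand lam p.1 p.2
        = ∑ n ∈ Finset.range N,
          Real.sin (2 * Real.pi * (n + 1 : ℕ) * (p.2 - p.1 - (1 - lam)) / lam)
            * chiBand lam p.1 p.2 := by
      intro p hp
      have hnot : (p.2, p.1) ∉ Set.Ioc 0 lam ×ˢ Set.Ioc (1 - lam) 1 := by
        intro h
        linarith [hp.1.2, h.2.1]
      rw [← Finset.sum_mul, symCornerKernel, cornerKernel, cornerKernel,
        Set.indicator_of_mem (show (p.1, p.2) ∈ _ from hp), Set.indicator_of_notMem hnot, add_zero,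
        conjDirichlet]
    rw [setIntegral_congr_fun (measurableSet_Ioc.prod measurableSet_Ioc) hcongr,
      integral_finsetSum]
    swap
    · intro n _
      refine integrableOn_prod_of_bounded (C := 1) measure_Ioc_lt_top measure_Ioc_lt_top ?_ ?_
      · exact Measurable.mul (by fun_prop) (measurable_chiBand lam)
      · intro p
        rw [abs_mul]
        exact mul_le_one₀ (Real.abs_sin_le_one _) (abs_nonneg _) (abs_chiBand_le_one _ _ _)
    simp_rw [setIntegral_sin_mul_chiBand h0 h1]
    rw [← Finset.mul_sum, neg_mul, abs_neg]
    exact le_abs_self _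
  · exact fun x hx => ⟨hx.1.le, by linarith [hx.2]⟩
  · exact fun x hx => ⟨by linarith [hx.1], hx.2⟩

/-- For every `0 < λ ≤ 1/2` and every `c > 0` there is a bounded symmetric
measurable function `w : [0,1]² → ℝ` with `‖B_λ(w)‖_□ > c·‖w‖_□`; i.e. the banded cut
`B_λ : w ↦ w·χ_λ` is unbounded in cut norm. -/
theorem bandedCut_unbounded (lam : ℝ) (hlam0 : 0 < lam) (hlam : lam ≤ 1 / 2)
    (c : ℝ) (hc : 0 < c) :
    ∃ w : ℝ → ℝ → ℝ,
      Measurable (fun p : ℝ × ℝ => w p.1 p.2) ∧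
      (∀ x y, w x y = w y x) ∧
      (∃ C : ℝ, ∀ x y, |w x y| ≤ C) ∧
      cutNormFn (fun x y => w x y * chiBand lam x y) > c * cutNormFn w := by
  obtain ⟨N, hN⟩ := (Real.tendsto_sum_range_one_div_nat_succ_atTop.eventually_gt_atTop
    (4 * Real.pi * c)).exists
  refine ⟨symCornerKernel lam N, measurable_symCornerKernel lam N, fun x y => add_comm _ _,
    ⟨_, abs_symCornerKernel_le lam N⟩, ?_⟩
  refine lt_of_lt_of_le ?_ (le_cutNormFn_symCornerKernel_mul_chiBand hlam0 hlam N)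
  calc c * cutNormFn (symCornerKernel lam N) ≤ c * (2 * lam ^ 2) :=
        mul_le_mul_of_nonneg_left (cutNormFn_symCornerKernel_le hlam0 N) hc.le
    _ = lam ^ 2 / (2 * Real.pi) * (4 * Real.pi * c) := by
        field_simp
        ring
    _ < _ := mul_lt_mul_of_pos_left hN (by positivity)
end

section
/- For every integer n ≥ 2, the matrix A_n with (A_n)_{ij} = 0 for i = j and (A_n)_{ij} = 1/(i−j) for i ≠ j satisfies ‖𝒯_n(A_n)‖_□ ≥ ((n·(H_{n−1} − 1) + 1)/(π·n))·‖A_n‖_□, where H_m = Σ_{k=1}^{m} 1/k is the m-th harmonic number. Consequently, sup_{A ∈ M_n(ℝ), ‖A‖_□ ≠ 0} ‖𝒯_n(A)‖_□ / ‖A‖_□ ≥ (n·(H_{n−1} − 1) + 1)/(π·n). -/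
open MeasureTheory Filter

/-- Cut norm of an `n × n` real matrix:
`(1/n²) · sup_{S,T ⊆ [n]} |∑_{i∈S, j∈T} a_ij|`. -/
noncomputable def cutNorm {n : ℕ} (A : Matrix (Fin n) (Fin n) ℝ) : ℝ :=
  (1 / (n : ℝ) ^ 2) * sSup {r : ℝ | ∃ S T : Finset (Fin n), r = |∑ i ∈ S, ∑ j ∈ T, A i j|}
/-- Triangular cut `𝒯_n(A) = A ∘ T_n`, where `(T_n)_{ij} = 1` if `i ≥ j` and `0` if `i < j`:
entries with `i < j` are set to zero. -/
def tri {n : ℕ} (A : Matrix (Fin n) (Fin n) ℝ) : Matrix (Fin n) (Fin n) ℝ :=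
  fun i j => if j ≤ i then A i j else 0
/-- The matrix `A_n` with `(A_n)_{ij} = 0` for `i = j` and `1/(i-j)` for `i ≠ j`. -/
noncomputable def An (n : ℕ) : Matrix (Fin n) (Fin n) ℝ :=
  fun i j => if i = j then 0 else 1 / (((i : ℕ) : ℝ) - ((j : ℕ) : ℝ))
/-- The `m`-th harmonic number `H_m = ∑_{k=1}^m 1/k` (with `H_0 = 0`). -/
noncomputable def H (m : ℕ) : ℝ := ∑ k ∈ Finset.range m, 1 / ((k : ℝ) + 1)

open intervalIntegral in
/-- The sawtooth `π - t` on `[0, 2π]` has sine coefficients `2π / k`. -/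
lemma integral_pi_sub_mul_sin {k : ℤ} (hk : k ≠ 0) :
    ∫ t in (0 : ℝ)..2 * Real.pi, (Real.pi - t) * Real.sin (k * t) = 2 * Real.pi * (1 / k) := by
  have hk' : (k : ℝ) ≠ 0 := by exact_mod_cast hk
  have hderiv : ∀ t : ℝ, HasDerivAt
      (fun t : ℝ => -(Real.pi - t) * Real.cos (k * t) / k - Real.sin (k * t) / k ^ 2)
      ((Real.pi - t) * Real.sin (k * t)) t := by
    intro t
    have h1 : HasDerivAt (fun t : ℝ => (k : ℝ) * t) k t := by
      simpa using (hasDerivAt_id t).const_mul (k : ℝ)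
    have h2 : HasDerivAt (fun t : ℝ => -(Real.pi - t)) 1 t := by
      simpa [Pi.neg_def] using ((hasDerivAt_id' t).const_sub Real.pi).neg
    refine (((h2.mul h1.cos).div_const (k : ℝ)).sub (h1.sin.div_const ((k : ℝ) ^ 2))).congr_deriv ?_
    field_simp
    ring
  rw [integral_eq_sub_of_hasDerivAt (fun t _ => hderiv t)
    ((by fun_prop : Continuous _).intervalIntegrable _ _)]
  have hc : Real.cos (k * (2 * Real.pi)) = 1 := Real.cos_int_mul_two_pi k
  have hs : Real.sin (k * (2 * Real.pi)) = 0 := by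
    have := Real.sin_int_mul_pi (k * 2)
    push_cast at this
    rwa [mul_assoc] at this
  simp only [hc, hs, mul_zero, Real.cos_zero, Real.sin_zero]
  field_simp
  ring

lemma integral_cos_int_mul (k : ℤ) :
    ∫ t in (0 : ℝ)..2 * Real.pi, Real.cos (k * t) = if k = 0 then 2 * Real.pi else 0 := by
  split_ifs with h
  · simp [h]
  · have hk' : (k : ℝ) ≠ 0 := by exact_mod_cast h
    have hs : Real.sin (k * (2 * Real.pi)) = 0 := by
      have := Real.sin_int_mul_pi (k * 2)
      push_cast at this
      rwa [mul_assoc] at this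
    rw [intervalIntegral.integral_comp_mul_left _ hk', integral_cos]
    simp [hs]

lemma integral_sq_sin_add_sq_cos {n : ℕ} (S : Finset (Fin n)) :
    ∫ t in (0 : ℝ)..2 * Real.pi,
      ((∑ i ∈ S, Real.sin ((i : ℕ) * t)) ^ 2 + (∑ i ∈ S, Real.cos ((i : ℕ) * t)) ^ 2)
      = 2 * Real.pi * S.card := by
  have hpt : ∀ t : ℝ,
      (∑ i ∈ S, Real.sin ((i : ℕ) * t)) ^ 2 + (∑ i ∈ S, Real.cos ((i : ℕ) * t)) ^ 2
      = ∑ i ∈ S, ∑ j ∈ S, Real.cos ((((i : ℕ) - (j : ℕ) : ℤ) : ℝ) * t) := by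
    intro t
    rw [sq, sq, Finset.sum_mul_sum, Finset.sum_mul_sum, ← Finset.sum_add_distrib]
    refine Finset.sum_congr rfl fun i _ => ?_
    rw [← Finset.sum_add_distrib]
    refine Finset.sum_congr rfl fun j _ => ?_
    push_cast
    rw [sub_mul, Real.cos_sub]
    ring
  simp_rw [hpt]
  rw [intervalIntegral.integral_finsetSum
    fun i _ => (by fun_prop : Continuous _).intervalIntegrable _ _]
  have hin : ∀ i ∈ S, ∫ t in (0 : ℝ)..2 * Real.pi,
      ∑ j ∈ S, Real.cos ((((i : ℕ) - (j : ℕ) : ℤ) : ℝ) * t) = 2 * Real.pi := by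
    intro i hi
    rw [intervalIntegral.integral_finsetSum
      fun i _ => (by fun_prop : Continuous _).intervalIntegrable _ _]
    simp_rw [integral_cos_int_mul, sub_eq_zero, Nat.cast_inj, Fin.val_inj]
    simp [hi]
  rw [Finset.sum_congr rfl hin]
  simp [mul_comm]

lemma two_pi_mul_An {n : ℕ} (i j : Fin n) :
    2 * Real.pi * An n i j = ∫ t in (0 : ℝ)..2 * Real.pi,
      (Real.pi - t) * Real.sin ((((i : ℕ) - (j : ℕ) : ℤ) : ℝ) * t) := by
  by_cases h : i = j
  · simp [An, h]
  · have hk : ((i : ℕ) - (j : ℕ) : ℤ) ≠ 0 := by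
      rw [sub_ne_zero]
      exact_mod_cast fun h' => h (Fin.ext h')
    rw [integral_pi_sub_mul_sin hk]
    simp [An, h]

/-- Hilbert's inequality for indicator vectors. -/
lemma abs_sum_An_le {n : ℕ} (S T : Finset (Fin n)) :
    |∑ i ∈ S, ∑ j ∈ T, An n i j| ≤ Real.pi * n := by
  have hpi := Real.pi_pos
  set s : Finset (Fin n) → ℝ → ℝ := fun U t => ∑ i ∈ U, Real.sin ((i : ℕ) * t) with hs
  set c : Finset (Fin n) → ℝ → ℝ := fun U t => ∑ i ∈ U, Real.cos ((i : ℕ) * t) with hc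
  have hsc : ∀ U, Continuous (s U) := fun U => by fun_prop
  have hcc : ∀ U, Continuous (c U) := fun U => by fun_prop
  have hrep : 2 * Real.pi * ∑ i ∈ S, ∑ j ∈ T, An n i j = ∫ t in (0 : ℝ)..2 * Real.pi,
      (Real.pi - t) * (s S t * c T t - c S t * s T t) := by
    have hpt : ∀ t : ℝ, (Real.pi - t) * (s S t * c T t - c S t * s T t) = ∑ i ∈ S, ∑ j ∈ T,
        (Real.pi - t) * Real.sin ((((i : ℕ) - (j : ℕ) : ℤ) : ℝ) * t) := by
      intro t
      simp only [hs, hc]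
      rw [Finset.sum_mul_sum, Finset.sum_mul_sum, ← Finset.sum_sub_distrib, Finset.mul_sum]
      refine Finset.sum_congr rfl fun i _ => ?_
      rw [← Finset.sum_sub_distrib, Finset.mul_sum]
      refine Finset.sum_congr rfl fun j _ => ?_
      push_cast
      rw [sub_mul _ _ t, Real.sin_sub]
    simp_rw [hpt]
    rw [intervalIntegral.integral_finsetSum
      fun i _ => (by fun_prop : Continuous _).intervalIntegrable _ _, Finset.mul_sum]
    refine Finset.sum_congr rfl fun i _ => ?_
    rw [intervalIntegral.integral_finsetSum
      fun i _ => (by fun_prop : Continuous _).intervalIntegrable _ _, Finset.mul_sum]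
    exact Finset.sum_congr rfl fun j _ => two_pi_mul_An i j
  have hbound : |2 * Real.pi * ∑ i ∈ S, ∑ j ∈ T, An n i j| ≤ ∫ t in (0 : ℝ)..2 * Real.pi,
      Real.pi / 2 * ((s S t ^ 2 + c S t ^ 2) + (s T t ^ 2 + c T t ^ 2)) := by
    rw [hrep, ← Real.norm_eq_abs]
    refine intervalIntegral.norm_integral_le_of_norm_le (by positivity) ?_
      ((by fun_prop : Continuous _).intervalIntegrable _ _)
    refine Filter.Eventually.of_forall fun t ht => ?_
    rw [Real.norm_eq_abs, abs_mul, div_mul_eq_mul_div, mul_div_assoc]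
    refine mul_le_mul (abs_le.2 ⟨by linarith [ht.2], by linarith [ht.1]⟩) ?_ (abs_nonneg _) hpi.le
    rw [abs_le]
    constructor <;> nlinarith [sq_nonneg (s S t + c T t), sq_nonneg (c S t - s T t),
      sq_nonneg (s S t - c T t), sq_nonneg (c S t + s T t)]
  rw [intervalIntegral.integral_const_mul, intervalIntegral.integral_add
    ((by fun_prop : Continuous _).intervalIntegrable _ _)
    ((by fun_prop : Continuous _).intervalIntegrable _ _),
    integral_sq_sin_add_sq_cos, integral_sq_sin_add_sq_cos, abs_mul,
    abs_of_pos (by positivity : 0 < 2 * Real.pi)] at hbound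
  have hcard : ∀ U : Finset (Fin n), (U.card : ℝ) ≤ n := fun U => by
    exact_mod_cast U.card_le_univ.trans_eq (Fintype.card_fin n)
  refine le_of_mul_le_mul_left (hbound.trans ?_) (by positivity : 0 < 2 * Real.pi)
  have : Real.pi ^ 2 * ((S.card : ℝ) + T.card) ≤ Real.pi ^ 2 * (n + n) := by
    exact mul_le_mul_of_nonneg_left (add_le_add (hcard S) (hcard T)) (by positivity)
  linarith

lemma le_cutNorm {n : ℕ} (A : Matrix (Fin n) (Fin n) ℝ) (S T : Finset (Fin n)) :
    1 / (n : ℝ) ^ 2 * |∑ i ∈ S, ∑ j ∈ T, A i j| ≤ cutNorm A := by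
  refine mul_le_mul_of_nonneg_left (le_csSup ?_ ⟨S, T, rfl⟩) (by positivity)
  refine ((Set.finite_range fun p : Finset (Fin n) × Finset (Fin n) =>
    |∑ i ∈ p.1, ∑ j ∈ p.2, A i j|).subset ?_).bddAbove
  rintro r ⟨S, T, rfl⟩
  exact ⟨(S, T), rfl⟩

lemma cutNorm_le {n : ℕ} {A : Matrix (Fin n) (Fin n) ℝ} {C : ℝ}
    (h : ∀ S T : Finset (Fin n), |∑ i ∈ S, ∑ j ∈ T, A i j| ≤ C) :
    cutNorm A ≤ 1 / (n : ℝ) ^ 2 * C := by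
  refine mul_le_mul_of_nonneg_left (csSup_le ⟨_, ∅, ∅, rfl⟩ ?_) (by positivity)
  rintro r ⟨S, T, rfl⟩
  exact h S T

lemma cutNorm_nonneg {n : ℕ} (A : Matrix (Fin n) (Fin n) ℝ) : 0 ≤ cutNorm A := by
  simpa using le_cutNorm A ∅ ∅

lemma abs_apply_le_cutNorm {n : ℕ} (A : Matrix (Fin n) (Fin n) ℝ) (i j : Fin n) :
    1 / (n : ℝ) ^ 2 * |A i j| ≤ cutNorm A := by
  simpa using le_cutNorm A {i} {j}

lemma cutNorm_tri_le {n : ℕ} (A : Matrix (Fin n) (Fin n) ℝ) :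
    cutNorm (tri A) ≤ (n : ℝ) ^ 2 * cutNorm A := by
  rcases Nat.eq_zero_or_pos n with rfl | hn
  · simp [cutNorm]
  have hn' : (0 : ℝ) < n := by exact_mod_cast hn
  have hentry : ∀ i j, |tri A i j| ≤ (n : ℝ) ^ 2 * cutNorm A := by
    intro i j
    have h0 := cutNorm_nonneg A
    unfold tri
    split_ifs
    · have := abs_apply_le_cutNorm A i j
      rwa [one_div, inv_mul_le_iff₀ (by positivity)] at this
    · rw [abs_zero]
      positivity
  have hsum : ∀ S T : Finset (Fin n), |∑ i ∈ S, ∑ j ∈ T, tri A i j|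
      ≤ (n : ℝ) ^ 2 * ((n : ℝ) ^ 2 * cutNorm A) := by
    intro S T
    calc |∑ i ∈ S, ∑ j ∈ T, tri A i j|
        ≤ ∑ i ∈ S, ∑ j ∈ T, |tri A i j| := (Finset.abs_sum_le_sum_abs _ _).trans
          (Finset.sum_le_sum fun i _ => Finset.abs_sum_le_sum_abs _ _)
      _ ≤ ∑ i ∈ S, ∑ j, |tri A i j| := Finset.sum_le_sum fun i _ =>
          Finset.sum_le_univ_sum_of_nonneg fun j => abs_nonneg _
      _ ≤ ∑ i, ∑ j, |tri A i j| :=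
          Finset.sum_le_univ_sum_of_nonneg fun i => Finset.sum_nonneg fun j _ => abs_nonneg _
      _ ≤ ∑ _i : Fin n, ∑ _j : Fin n, (n : ℝ) ^ 2 * cutNorm A :=
          Finset.sum_le_sum fun i _ => Finset.sum_le_sum fun j _ => hentry i j
      _ = (n : ℝ) ^ 2 * ((n : ℝ) ^ 2 * cutNorm A) := by
          simp
          ring
  refine (cutNorm_le hsum).trans_eq ?_
  field_simp

lemma sum_range_succ_H (m : ℕ) :
    ∑ i ∈ Finset.range (m + 1), H i = ((m + 1 : ℕ) : ℝ) * (H m - 1) + 1 := by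
  induction m with
  | zero => simp [H]
  | succ m ih =>
    have hH : H (m + 1) = H m + 1 / ((m : ℝ) + 1) := Finset.sum_range_succ _ _
    rw [Finset.sum_range_succ, ih, hH]
    push_cast
    field_simp
    ring

lemma sum_tri_An_row {n : ℕ} (i : Fin n) : ∑ j, tri (An n) i j = H i := by
  have h1 : ∀ j : Fin n, tri (An n) i j =
      (fun k : ℕ => if k < (i : ℕ) then 1 / (((i : ℕ) : ℝ) - k) else 0) j := by
    intro j
    simp only [tri, An, Fin.le_def, Fin.ext_iff]
    split_ifs <;> first | rfl | omega
  rw [Finset.sum_congr rfl fun j _ => h1 j, Fin.sum_univ_eq_sum_range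
    (fun k : ℕ => if k < (i : ℕ) then 1 / (((i : ℕ) : ℝ) - k) else 0), ← Finset.sum_filter]
  have h2 : (Finset.range n).filter (fun k => k < (i : ℕ)) = Finset.range i := by
    ext k
    simp only [Finset.mem_filter, Finset.mem_range]
    omega
  rw [h2, H, ← Finset.sum_range_reflect]
  refine Finset.sum_congr rfl fun k hk => ?_
  have hk := Finset.mem_range.1 hk
  rw [show (i : ℕ) - 1 - k = i - (k + 1) by omega, Nat.cast_sub (by omega)]
  push_cast
  congr 1
  ring

lemma sum_tri_An {n : ℕ} (hn : 1 ≤ n) :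
    ∑ i, ∑ j, tri (An n) i j = (n : ℝ) * (H (n - 1) - 1) + 1 := by
  obtain ⟨m, rfl⟩ := Nat.exists_eq_add_of_le' hn
  simp_rw [sum_tri_An_row]
  rw [Fin.sum_univ_eq_sum_range H, sum_range_succ_H, Nat.add_sub_cancel]

/-- For every `n ≥ 2`,
`‖𝒯ₙ(Aₙ)‖_□ ≥ ((n·(H_{n-1} - 1) + 1)/(π·n))·‖Aₙ‖_□`, and consequently
`sup_{A ∈ Mₙ(ℝ), ‖A‖_□ ≠ 0} ‖𝒯ₙ(A)‖_□ / ‖A‖_□ ≥ (n·(H_{n-1} - 1) + 1)/(π·n)`. -/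
theorem triCut_An_ratio (n : ℕ) (hn : 2 ≤ n) :
    cutNorm (tri (An n)) ≥
      (((n : ℝ) * (H (n - 1) - 1) + 1) / (Real.pi * n)) * cutNorm (An n) ∧
    sSup {r : ℝ | ∃ A : Matrix (Fin n) (Fin n) ℝ,
        cutNorm A ≠ 0 ∧ r = cutNorm (tri A) / cutNorm A} ≥
      ((n : ℝ) * (H (n - 1) - 1) + 1) / (Real.pi * n) := by
  have hn' : (0 : ℝ) < n := by exact_mod_cast (by omega : 0 < n)
  have hpi := Real.pi_pos
  have hsum := sum_tri_An (n := n) (by omega)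
  set h : ℝ := (n : ℝ) * (H (n - 1) - 1) + 1 with hh
  have hh0 : 0 ≤ h := by
    rw [← hsum]
    refine Finset.sum_nonneg fun i _ => ?_
    rw [sum_tri_An_row]
    exact Finset.sum_nonneg fun k _ => by positivity
  have hfirst : h / (Real.pi * n) * cutNorm (An n) ≤ cutNorm (tri (An n)) :=
    calc h / (Real.pi * n) * cutNorm (An n)
        ≤ h / (Real.pi * n) * (1 / (n : ℝ) ^ 2 * (Real.pi * n)) :=
          mul_le_mul_of_nonneg_left (cutNorm_le abs_sum_An_le) (by positivity)
      _ = 1 / (n : ℝ) ^ 2 * |∑ i, ∑ j, tri (An n) i j| := by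
          rw [hsum, abs_of_nonneg hh0]
          field_simp
      _ ≤ cutNorm (tri (An n)) := le_cutNorm _ _ _
  have hpos : 0 < cutNorm (An n) := by
    refine lt_of_lt_of_le ?_ (abs_apply_le_cutNorm (An n) ⟨1, by omega⟩ ⟨0, by omega⟩)
    have : An n ⟨1, by omega⟩ ⟨0, by omega⟩ = 1 := by simp [An]
    rw [this]
    positivity
  refine ⟨hfirst, ((le_div_iff₀ hpos).2 hfirst).trans (le_csSup ?_ ⟨An n, hpos.ne', rfl⟩)⟩
  refine ⟨(n : ℝ) ^ 2, ?_⟩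
  rintro r ⟨A, hA, rfl⟩
  exact (div_le_iff₀ ((cutNorm_nonneg A).lt_of_ne' hA)).2 (cutNorm_tri_le A)
end
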